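/- arXiv:1510.00853 — 15 statements merged into one kernel-verified Lean document; each statement's English description precedes it below -/
import Mathlib

section
/- The planar vector field associated with f has identically vanishing divergence (i.e., for every point z = x + iy ∈ ℂ, the partial derivative in the x-direction of the real part of f plus the partial derivative in the y-direction of the imaginary part of f equals zero) if and only if p₁ = 0 and s₁ = 0. Equivalently, the differential equation dz/dt = f(z) is Hamiltonian exactly when p₁ = s₁ = 0. -/
open Complex ComplexConjugate in
/-- A monomial in `z` and `z̄` has Wirtinger derivatives as expected. -/
theorem hasFDerivAt_mul_pow_mul_conj_pow (c : ℂ) (a b : ℕ) (z : ℂ) :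
    HasFDerivAt (fun w : ℂ => c * w ^ a * conj w ^ b)
      ((c * (a * z ^ (a - 1)) * conj z ^ b) • ContinuousLinearMap.id ℝ ℂ
        + (c * z ^ a * (b * conj z ^ (b - 1))) • (conjCLE : ℂ →L[ℝ] ℂ)) z := by
  have h₁ : HasFDerivAt (fun w : ℂ => w ^ a) _ z := (hasFDerivAt_id (𝕜 := ℝ) z).pow a
  have h₂ : HasFDerivAt (fun w : ℂ => conj w ^ b) _ z :=
    ((conjCLE : ℂ →L[ℝ] ℂ).hasFDerivAt (x := z)).pow b
  refine ((h₁.const_mul c).mul h₂).congr_fderiv ?_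
  ext v
  simp
  ring

open Complex in
/-- The Wirtinger derivatives `∂/∂z` and `∂/∂z̄` are additive. -/
theorem hasFDerivAt_add_smul_id_add_smul_conj {f g : ℂ → ℂ} {A B C D z : ℂ}
    (hf : HasFDerivAt f
      (A • ContinuousLinearMap.id ℝ ℂ + B • (conjCLE : ℂ →L[ℝ] ℂ)) z)
    (hg : HasFDerivAt g
      (C • ContinuousLinearMap.id ℝ ℂ + D • (conjCLE : ℂ →L[ℝ] ℂ)) z) :
    HasFDerivAt (fun w => f w + g w)
      ((A + C) • ContinuousLinearMap.id ℝ ℂ + (B + D) • (conjCLE : ℂ →L[ℝ] ℂ)) z := by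
  refine (hf.add hg).congr_fderiv ?_
  ext v
  simp
  ring

open Complex in
/-- The divergence of a planar vector field is twice the real part of its `∂/∂z` derivative. -/
theorem fderiv_re_one_add_fderiv_im_I {f : ℂ → ℂ} {A B z : ℂ}
    (h : HasFDerivAt f
      (A • ContinuousLinearMap.id ℝ ℂ + B • (conjCLE : ℂ →L[ℝ] ℂ)) z) :
    fderiv ℝ (fun w : ℂ => (f w).re) z 1 + fderiv ℝ (fun w : ℂ => (f w).im) z I
      = 2 * A.re := by
  have hre : HasFDerivAt (fun w : ℂ => (f w).re) _ z := reCLM.hasFDerivAt.comp z h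
  have him : HasFDerivAt (fun w : ℂ => (f w).im) _ z := imCLM.hasFDerivAt.comp z h
  rw [hre.fderiv, him.fderiv]
  simp
  ring

/-- The planar vector field `(x,y) ↦ (Re f(x+iy), Im f(x+iy))` associated with
`f(z) = 𝐩 z^{n-1} z̄^{n-2} + 𝐬 z^n z̄^{n-1} − z̄^{2n-1}` has identically vanishing
divergence (so the equation `ż = f(z)` is Hamiltonian) if and only if `p₁ = 0` and `s₁ = 0`. -/
theorem stmt_1 (n : ℕ) (hn : 4 ≤ n) (p₁ p₂ s₁ s₂ : ℝ) (f : ℂ → ℂ)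
    (hf : ∀ z : ℂ, f z =
      ((p₁ : ℂ) + p₂ * Complex.I) * z ^ (n - 1) * (starRingEnd ℂ) z ^ (n - 2)
        + ((s₁ : ℂ) + s₂ * Complex.I) * z ^ n * (starRingEnd ℂ) z ^ (n - 1)
        - (starRingEnd ℂ) z ^ (2 * n - 1)) :
    (∀ z : ℂ,
        fderiv ℝ (fun w : ℂ => (f w).re) z 1
          + fderiv ℝ (fun w : ℂ => (f w).im) z Complex.I = 0)
      ↔ (p₁ = 0 ∧ s₁ = 0) := by
  obtain ⟨k, rfl⟩ : ∃ k, n = k + 2 := ⟨n - 2, by omega⟩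
  have div_eq (z : ℂ) :
      fderiv ℝ (fun w : ℂ => (f w).re) z 1 + fderiv ℝ (fun w : ℂ => (f w).im) z Complex.I
        = 2 * ((k + 1) * p₁ * Complex.normSq z ^ k
          + (k + 2) * s₁ * Complex.normSq z ^ (k + 1)) := by
    have h := hasFDerivAt_add_smul_id_add_smul_conj
      (hasFDerivAt_add_smul_id_add_smul_conj
        (hasFDerivAt_mul_pow_mul_conj_pow (p₁ + p₂ * Complex.I) (k + 1) k z)
        (hasFDerivAt_mul_pow_mul_conj_pow (s₁ + s₂ * Complex.I) (k + 2) (k + 1) z))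
      (hasFDerivAt_mul_pow_mul_conj_pow (-1) 0 (2 * k + 3) z)
    have hf' : HasFDerivAt f _ z := h.congr_of_eventuallyEq <| .of_forall fun w => by
      rw [hf, show 2 * (k + 2) - 1 = 2 * k + 3 by omega]
      simp [sub_eq_add_neg]
    rw [fderiv_re_one_add_fderiv_im_I hf']
    congr 1
    refine congrArg Complex.re (a₂ := ⟨(k + 1) * p₁ * Complex.normSq z ^ k
        + (k + 2) * s₁ * Complex.normSq z ^ (k + 1),
      (k + 1) * p₂ * Complex.normSq z ^ k + (k + 2) * s₂ * Complex.normSq z ^ (k + 1)⟩) ?_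
    rw [Complex.mk_eq_add_mul_I]
    push_cast
    simp only [Complex.normSq_eq_conj_mul_self, mul_pow]
    ring
  simp only [div_eq]
  constructor
  · intro h
    have h₁ := h 1
    have h₂ := h 2
    have hk : (0 : ℝ) < k + 1 := by positivity
    have hk' : (0 : ℝ) < k + 2 := by positivity
    have h4 : (4 : ℝ) ^ k ≠ 0 := by positivity
    rw [show Complex.normSq 2 = 4 by norm_num [Complex.normSq_apply]] at h₂
    simp only [map_one, one_pow, mul_one] at h₁
    have h₃ : (k + 1) * p₁ + 4 * ((k + 2) * s₁) = 0 := by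
      apply mul_left_cancel₀ h4
      linear_combination h₂ / 2
    have hs : (k + 2) * s₁ = 0 := by linarith
    have hp : (k + 1) * p₁ = 0 := by linarith
    exact ⟨(mul_eq_zero.mp hp).resolve_left hk.ne', (mul_eq_zero.mp hs).resolve_left hk'.ne'⟩
  · rintro ⟨rfl, rfl⟩ z
    simp
end

section
/- If |s₂| > 1, then ∫₀^{2π} −2(s₁ − cos(2nθ))/(s₂ + sin(2nθ)) dθ = −sgn(s₂)·4π s₁/√(s₂² − 1), where sgn(s₂) is the sign of s₂. In particular this integral is negative when s₁s₂ > 0 (so infinity is an attractor) and positive when s₁s₂ < 0 (so infinity is a repeller). -/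
open Real in
lemma add_sin_ne_zero {s : ℝ} (hs : 1 < |s|) (y : ℝ) : s + sin y ≠ 0 := by
  intro h
  have : |s| = |sin y| := by rw [eq_neg_of_add_eq_zero_left h, abs_neg]
  linarith [abs_sin_le_one y]

open Real in
/-- A global primitive of `w / (s + sin y)`, where `w ^ 2 = s ^ 2 - 1` and `q = s - w` is the root
of `q ^ 2 - 2 * s * q + 1` in the open unit disc. -/
lemma hasDerivAt_add_two_mul_arctan {s q : ℝ} (hq : q ^ 2 + 1 = 2 * s * q) (hq1 : |q| < 1)
    (hs : 1 < |s|) (y : ℝ) :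
    HasDerivAt (fun y => y + 2 * arctan (q * cos y / (1 + q * sin y)))
      ((s - q) / (s + sin y)) y := by
  have hD : 0 < 1 + q * sin y := by
    have h : |q * sin y| < 1 := by
      rw [abs_mul]
      nlinarith [abs_sin_le_one y, abs_nonneg q, abs_nonneg (sin y)]
    linarith [(abs_lt.mp h).1]
  have hq0 : q ≠ 0 := by
    rintro rfl
    norm_num at hq
  have hS := add_sin_ne_zero hs y
  have hsum : (1 + q * sin y) ^ 2 + (q * cos y) ^ 2 = 2 * q * (s + sin y) := by
    linear_combination q ^ 2 * sin_sq_add_cos_sq y + hq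
  have hquot : 1 + (q * cos y / (1 + q * sin y)) ^ 2
      = 2 * q * (s + sin y) / (1 + q * sin y) ^ 2 := by
    rw [← hsum]
    field_simp
  have hN : HasDerivAt (fun y => q * cos y) (q * -sin y) y := (hasDerivAt_cos y).const_mul q
  have hD' : HasDerivAt (fun y => 1 + q * sin y) (q * cos y) y :=
    ((hasDerivAt_sin y).const_mul q).const_add 1
  refine ((hasDerivAt_id y).add (((hN.div hD' hD.ne').arctan).const_mul 2)).congr_deriv ?_
  simp only [Pi.div_apply]
  rw [hquot]
  have hD0 := hD.ne'
  field_simp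
  linear_combination -q * sin_sq_add_cos_sq y

open Real in
lemma integral_sub_cos_div_add_sin {n : ℕ} (hn : n ≠ 0) (a : ℝ) {s q : ℝ}
    (hq : q ^ 2 + 1 = 2 * s * q) (hq1 : |q| < 1) (hs : 1 < |s|) :
    (∫ θ in (0 : ℝ)..(2 * π), -2 * (a - cos (2 * n * θ)) / (s + sin (2 * n * θ)))
      = -(4 * π * a / (s - q)) := by
  have hn0 : (n : ℝ) ≠ 0 := Nat.cast_ne_zero.mpr hn
  have hS := add_sin_ne_zero hs
  have hw : s - q ≠ 0 := by
    intro h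
    rw [sub_eq_zero.mp h] at hs
    linarith
  have hderiv (θ : ℝ) : HasDerivAt
      (fun θ : ℝ => -(a / (n * (s - q))) * (2 * n * θ + 2 * arctan (q * cos (2 * n * θ) /
        (1 + q * sin (2 * n * θ)))) + 1 / n * log (s + sin (2 * n * θ)))
      (-2 * (a - cos (2 * n * θ)) / (s + sin (2 * n * θ))) θ := by
    have hlin : HasDerivAt (fun θ : ℝ => 2 * n * θ) (2 * n : ℝ) θ := by
      simpa using (hasDerivAt_id θ).const_mul (2 * n : ℝ)
    have h1 := (hasDerivAt_add_two_mul_arctan hq hq1 hs (2 * n * θ)).comp θ hlin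
    have h2 := (hlin.sin.const_add s).log (hS _)
    refine ((h1.const_mul (-(a / (n * (s - q))))).add (h2.const_mul (1 / n : ℝ))).congr_deriv ?_
    have := hS (2 * n * θ)
    field_simp
    ring
  have hcont : Continuous fun θ : ℝ => -2 * (a - cos (2 * n * θ)) / (s + sin (2 * n * θ)) :=
    Continuous.div (by fun_prop) (by fun_prop) fun θ => hS _
  rw [intervalIntegral.integral_eq_sub_of_hasDerivAt (fun θ _ => hderiv θ)
    (hcont.intervalIntegrable _ _)]
  have hcos : cos (2 * n * (2 * π)) = 1 := by
    simpa using cos_nat_mul_two_pi (2 * n)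
  have hsin : sin (2 * n * (2 * π)) = 0 := by
    rw [show 2 * n * (2 * π) = ((4 * n : ℕ) : ℝ) * π by push_cast; ring]
    exact sin_nat_mul_pi _
  rw [hcos, hsin]
  simp only [mul_zero, cos_zero, sin_zero]
  field_simp
  ring

/-- For `|s₂| > 1`, the integral determining the stability of infinity equals
`−sgn(s₂)·4πs₁/√(s₂²−1)`; in particular it is negative when `s₁s₂ > 0`
(infinity is an attractor) and positive when `s₁s₂ < 0` (infinity is a repeller). -/
theorem stmt_3 (n : ℕ) (hn : 4 ≤ n) (p₁ p₂ s₁ s₂ : ℝ) (hs₂ : 1 < |s₂|) :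
    (∫ θ in (0 : ℝ)..(2 * Real.pi),
        -2 * (s₁ - Real.cos (2 * n * θ)) / (s₂ + Real.sin (2 * n * θ)))
      = -(Real.sign s₂) * 4 * Real.pi * s₁ / Real.sqrt (s₂ ^ 2 - 1) ∧
    (0 < s₁ * s₂ →
      (∫ θ in (0 : ℝ)..(2 * Real.pi),
        -2 * (s₁ - Real.cos (2 * n * θ)) / (s₂ + Real.sin (2 * n * θ))) < 0) ∧
    (s₁ * s₂ < 0 →
      0 < ∫ θ in (0 : ℝ)..(2 * Real.pi),
        -2 * (s₁ - Real.cos (2 * n * θ)) / (s₂ + Real.sin (2 * n * θ))) := by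
  set r := Real.sqrt (s₂ ^ 2 - 1)
  have hsq : 0 < s₂ ^ 2 - 1 := by
    rw [← sq_abs]
    nlinarith
  have hr0 : 0 < r := Real.sqrt_pos.mpr hsq
  have hr2 : r ^ 2 = s₂ ^ 2 - 1 := Real.sq_sqrt hsq.le
  have hπ := Real.pi_pos
  rcases lt_abs.mp hs₂ with h | h
  · have hs0 : 0 < s₂ := by linarith
    rw [integral_sub_cos_div_add_sin (q := s₂ - r) (by omega) s₁ (by linear_combination hr2)
      (abs_lt.mpr ⟨by nlinarith, by nlinarith⟩) hs₂, Real.sign_of_pos hs0, sub_sub_cancel]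
    refine ⟨by ring, fun h' => ?_, fun h' => ?_⟩
    · have hs1 : 0 < s₁ := pos_of_mul_pos_left h' hs0.le
      exact neg_neg_of_pos (by positivity)
    · have hs1 : s₁ < 0 := by nlinarith
      exact neg_pos.mpr (div_neg_of_neg_of_pos (mul_neg_of_pos_of_neg (by positivity) hs1) hr0)
  · have hs0 : s₂ < 0 := by linarith
    rw [integral_sub_cos_div_add_sin (q := s₂ + r) (by omega) s₁ (by linear_combination hr2)
      (abs_lt.mpr ⟨by nlinarith, by nlinarith⟩) hs₂, Real.sign_of_neg hs0, sub_add_cancel_left,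
      div_neg, neg_neg]
    refine ⟨by ring, fun h' => ?_, fun h' => ?_⟩
    · have hs1 : s₁ < 0 := by nlinarith
      exact div_neg_of_neg_of_pos (mul_neg_of_pos_of_neg (by positivity) hs1) hr0
    · have hs1 : 0 < s₁ := by nlinarith
      positivity
end

section
/- If p₁ > 0, then for every complex number z with 0 < |z|² < p₁/(1 + |s₁|) one has Re(z̄·f(z)) > 0; if p₁ < 0, then for every z with 0 < |z|² < −p₁/(1 + |s₁|) one has Re(z̄·f(z)) < 0. (Hence the squared modulus |z|² is strictly increasing, respectively decreasing, along trajectories of ż = f(z) near the origin, so the origin is unstable when p₁ > 0 and asymptotically stable when p₁ < 0.) -/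
open ComplexConjugate in
/-- The radial component of the vector field is a leading term, proportional to `p₁`, plus a
remainder of higher order. -/
lemma abs_re_conj_mul_field_sub_le (m : ℕ) (p₁ p₂ s₁ s₂ : ℝ) (z : ℂ) :
    |(conj z * (((p₁ : ℂ) + p₂ * Complex.I) * z ^ (m + 1) * conj z ^ m
        + ((s₁ : ℂ) + s₂ * Complex.I) * z ^ (m + 2) * conj z ^ (m + 1)
        - conj z ^ (2 * m + 3))).re - p₁ * Complex.normSq z ^ (m + 1)|
      ≤ (1 + |s₁|) * Complex.normSq z ^ (m + 2) := by
  set r := Complex.normSq z with hr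
  have hr0 : 0 ≤ r := Complex.normSq_nonneg z
  have hfield : conj z * (((p₁ : ℂ) + p₂ * Complex.I) * z ^ (m + 1) * conj z ^ m
        + ((s₁ : ℂ) + s₂ * Complex.I) * z ^ (m + 2) * conj z ^ (m + 1)
        - conj z ^ (2 * m + 3))
      = ((p₁ : ℂ) + p₂ * Complex.I) * ((r ^ (m + 1) : ℝ) : ℂ)
        + ((s₁ : ℂ) + s₂ * Complex.I) * ((r ^ (m + 2) : ℝ) : ℂ) - conj z ^ (2 * (m + 2)) := by
    push_cast
    rw [hr, Complex.normSq_eq_conj_mul_self]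
    ring
  have hre : (conj z * (((p₁ : ℂ) + p₂ * Complex.I) * z ^ (m + 1) * conj z ^ m
        + ((s₁ : ℂ) + s₂ * Complex.I) * z ^ (m + 2) * conj z ^ (m + 1)
        - conj z ^ (2 * m + 3))).re - p₁ * r ^ (m + 1)
      = s₁ * r ^ (m + 2) - (conj z ^ (2 * (m + 2))).re := by
    rw [hfield, Complex.sub_re, Complex.add_re, Complex.re_mul_ofReal, Complex.re_mul_ofReal]
    simp only [Complex.add_re, Complex.ofReal_re, Complex.re_ofReal_mul, Complex.I_re]
    ring
  have hconj : |(conj z ^ (2 * (m + 2))).re| ≤ r ^ (m + 2) := by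
    refine (Complex.abs_re_le_norm _).trans_eq ?_
    rw [norm_pow, Complex.norm_conj, pow_mul, hr, Complex.normSq_eq_norm_sq]
  rw [hre]
  calc |s₁ * r ^ (m + 2) - (conj z ^ (2 * (m + 2))).re|
      ≤ |s₁ * r ^ (m + 2)| + |(conj z ^ (2 * (m + 2))).re| := abs_sub _ _
    _ ≤ |s₁| * r ^ (m + 2) + r ^ (m + 2) := by
        rw [abs_mul, abs_of_nonneg (pow_nonneg hr0 (m + 2))]
        gcongr
    _ = (1 + |s₁|) * r ^ (m + 2) := by ring

/-- Near the origin, `Re(z̄·f(z))` has the sign of `p₁`: if `p₁ > 0` it is positive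
for `0 < |z|² < p₁/(1+|s₁|)`, and if `p₁ < 0` it is negative for
`0 < |z|² < −p₁/(1+|s₁|)`.  Hence the origin is unstable when `p₁ > 0` and
asymptotically stable when `p₁ < 0`. -/
theorem stmt_4 (n : ℕ) (hn : 4 ≤ n) (p₁ p₂ s₁ s₂ : ℝ) (f : ℂ → ℂ)
    (hf : ∀ z : ℂ, f z =
      ((p₁ : ℂ) + p₂ * Complex.I) * z ^ (n - 1) * (starRingEnd ℂ) z ^ (n - 2)
        + ((s₁ : ℂ) + s₂ * Complex.I) * z ^ n * (starRingEnd ℂ) z ^ (n - 1)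
        - (starRingEnd ℂ) z ^ (2 * n - 1)) :
    (0 < p₁ → ∀ z : ℂ, 0 < Complex.normSq z → Complex.normSq z < p₁ / (1 + |s₁|) →
      0 < ((starRingEnd ℂ) z * f z).re) ∧
    (p₁ < 0 → ∀ z : ℂ, 0 < Complex.normSq z → Complex.normSq z < -p₁ / (1 + |s₁|) →
      ((starRingEnd ℂ) z * f z).re < 0) := by
  obtain ⟨m, rfl⟩ : ∃ m, n = m + 2 := ⟨n - 2, by omega⟩
  have hbound (z : ℂ) := abs_le.mp (abs_re_conj_mul_field_sub_le m p₁ p₂ s₁ s₂ z)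
  have hs : 0 < 1 + |s₁| := by positivity
  simp only [hf, show m + 2 - 1 = m + 1 by omega, show m + 2 - 2 = m by omega,
    show 2 * (m + 2) - 1 = 2 * m + 3 by omega]
  refine ⟨fun _ z hz hlt => ?_, fun _ z hz hlt => ?_⟩
  · rw [lt_div_iff₀ hs] at hlt
    have hlead := mul_lt_mul_of_pos_right hlt (pow_pos hz (m + 1))
    have hrem := (hbound z).1
    rw [pow_succ (Complex.normSq z) (m + 1)] at hrem
    linarith
  · rw [lt_div_iff₀ hs] at hlt
    have hlead := mul_lt_mul_of_pos_right hlt (pow_pos hz (m + 1))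
    have hrem := (hbound z).2
    rw [pow_succ (Complex.normSq z) (m + 1)] at hrem
    linarith
end

section
/- Suppose p₁ = 0. If s₁ > 1, then for every nonzero complex number z one has Re(z̄·f(z)) > 0; if s₁ < −1, then for every nonzero z one has Re(z̄·f(z)) < 0. (Hence for p₁ = 0 the origin is unstable when s₁ > 1 and asymptotically stable when s₁ < −1.) -/
theorem re_conj_mul_equivariant_field (n : ℕ) (hn : 2 ≤ n) (p s z : ℂ) :
    ((starRingEnd ℂ) z * (p * z ^ (n - 1) * (starRingEnd ℂ) z ^ (n - 2)
        + s * z ^ n * (starRingEnd ℂ) z ^ (n - 1) - (starRingEnd ℂ) z ^ (2 * n - 1))).re =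
      p.re * ‖z‖ ^ (2 * (n - 1)) + s.re * ‖z‖ ^ (2 * n) - ((starRingEnd ℂ) z ^ (2 * n)).re := by
  obtain ⟨m, rfl⟩ := Nat.exists_eq_add_of_le' hn
  have h : (starRingEnd ℂ) z * (p * z ^ (m + 1) * (starRingEnd ℂ) z ^ m
        + s * z ^ (m + 2) * (starRingEnd ℂ) z ^ (m + 1) - (starRingEnd ℂ) z ^ (2 * m + 3)) =
      p * (z * (starRingEnd ℂ) z) ^ (m + 1) + s * (z * (starRingEnd ℂ) z) ^ (m + 2)
        - (starRingEnd ℂ) z ^ (2 * (m + 2)) := by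
    ring
  have e : 2 * (m + 2) - 1 = 2 * m + 3 := by omega
  rw [e]
  simp only [Nat.add_sub_cancel, Nat.add_succ_sub_one]
  rw [h, Complex.mul_conj']
  simp only [← pow_mul, ← Complex.ofReal_pow, Complex.sub_re, Complex.add_re, Complex.re_mul_ofReal]

/-- When `p₁ = 0`: if `s₁ > 1` then `Re(z̄·f(z)) > 0` for every nonzero `z`
(the origin is unstable), and if `s₁ < −1` then `Re(z̄·f(z)) < 0` for every
nonzero `z` (the origin is asymptotically stable). -/
theorem stmt_5 (n : ℕ) (hn : 4 ≤ n) (p₁ p₂ s₁ s₂ : ℝ) (hp₁ : p₁ = 0) (f : ℂ → ℂ)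
    (hf : ∀ z : ℂ, f z =
      ((p₁ : ℂ) + p₂ * Complex.I) * z ^ (n - 1) * (starRingEnd ℂ) z ^ (n - 2)
        + ((s₁ : ℂ) + s₂ * Complex.I) * z ^ n * (starRingEnd ℂ) z ^ (n - 1)
        - (starRingEnd ℂ) z ^ (2 * n - 1)) :
    (1 < s₁ → ∀ z : ℂ, z ≠ 0 → 0 < ((starRingEnd ℂ) z * f z).re) ∧
    (s₁ < -1 → ∀ z : ℂ, z ≠ 0 → ((starRingEnd ℂ) z * f z).re < 0) := by
  have hre (z : ℂ) : ((starRingEnd ℂ) z * f z).re =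
      s₁ * ‖z‖ ^ (2 * n) - ((starRingEnd ℂ) z ^ (2 * n)).re := by
    rw [hf, re_conj_mul_equivariant_field n (by omega)]
    simp [hp₁]
  have habs (z : ℂ) : |((starRingEnd ℂ) z ^ (2 * n)).re| ≤ ‖z‖ ^ (2 * n) := by
    simpa using Complex.abs_re_le_norm ((starRingEnd ℂ) z ^ (2 * n))
  refine ⟨fun hs z hz => ?_, fun hs z hz => ?_⟩ <;>
  · have hpos : 0 < ‖z‖ ^ (2 * n) := pow_pos (norm_pos_iff.mpr hz) _
    have := abs_le.mp (habs z)
    rw [hre]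
    nlinarith
end

section
/- Assume |s₂| > 1 and p₁ ≠ 0. Then there exist a real number r ≠ 0 and an angle φ ∈ ℝ satisfying the equilibrium equations 0 = p₁ + r(s₁ − cos(2φ)) and 0 = p₂ + r(s₂ + sin(2φ)) if and only if Δ := p₁² + p₂² − (p₁s₂ − p₂s₁)² ≥ 0. -/
theorem exists_cos_eq_sin_eq {x y : ℝ} (h : x ^ 2 + y ^ 2 = 1) :
    ∃ θ : ℝ, Real.cos θ = x ∧ Real.sin θ = y := by
  have hn : ‖(⟨x, y⟩ : ℂ)‖ = 1 := by
    rw [← sq_eq_sq₀ (norm_nonneg _) zero_le_one, Complex.sq_norm, Complex.normSq_mk]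
    linarith
  have h0 : (⟨x, y⟩ : ℂ) ≠ 0 := norm_ne_zero_iff.mp (by rw [hn]; exact one_ne_zero)
  exact ⟨Complex.arg ⟨x, y⟩, by rw [Complex.cos_arg h0, hn, div_one],
    by rw [Complex.sin_arg, hn, div_one]⟩

/-- The line `u ↦ s + u p` meets the unit circle when its discriminant is nonnegative. -/
theorem exists_line_mem_unit_circle {p₁ p₂ s₁ s₂ : ℝ} (hp₁ : p₁ ≠ 0)
    (h : 0 ≤ p₁ ^ 2 + p₂ ^ 2 - (p₁ * s₂ - p₂ * s₁) ^ 2) :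
    ∃ u : ℝ, (s₁ + u * p₁) ^ 2 + (s₂ + u * p₂) ^ 2 = 1 := by
  have hp : p₁ ^ 2 + p₂ ^ 2 ≠ 0 := by positivity
  obtain ⟨d, hd⟩ : ∃ d : ℝ, d ^ 2 = p₁ ^ 2 + p₂ ^ 2 - (p₁ * s₂ - p₂ * s₁) ^ 2 :=
    ⟨_, Real.sq_sqrt h⟩
  refine ⟨(d - (p₁ * s₁ + p₂ * s₂)) / (p₁ ^ 2 + p₂ ^ 2), ?_⟩
  field_simp
  linear_combination (p₁ ^ 2 + p₂ ^ 2) * hd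

/-- For `|s₂| > 1` and `p₁ ≠ 0`, nontrivial equilibria of the polar system
(`r ≠ 0` solving `0 = p₁ + r(s₁ − cos 2φ)` and `0 = p₂ + r(s₂ + sin 2φ)`)
exist iff `Δ = p₁² + p₂² − (p₁s₂ − p₂s₁)² ≥ 0`. -/
theorem stmt_6 (p₁ p₂ s₁ s₂ : ℝ) (hs₂ : 1 < |s₂|) (hp₁ : p₁ ≠ 0) :
    (∃ (r φ : ℝ), r ≠ 0 ∧
        0 = p₁ + r * (s₁ - Real.cos (2 * φ)) ∧
        0 = p₂ + r * (s₂ + Real.sin (2 * φ)))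
      ↔ 0 ≤ p₁ ^ 2 + p₂ ^ 2 - (p₁ * s₂ - p₂ * s₁) ^ 2 := by
  constructor
  · rintro ⟨r, φ, -, h₁, h₂⟩
    have hcs := Real.sin_sq_add_cos_sq (2 * φ)
    generalize Real.cos (2 * φ) = c at *
    generalize Real.sin (2 * φ) = s at *
    obtain rfl : p₁ = r * (c - s₁) := by linarith
    obtain rfl : p₂ = -(r * (s₂ + s)) := by linarith
    have hsq : (r * (c - s₁)) ^ 2 + (-(r * (s₂ + s))) ^ 2
        - (r * (c - s₁) * s₂ - -(r * (s₂ + s)) * s₁) ^ 2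
        = (r * (c - s₁) * c + r * (s₂ + s) * s) ^ 2 := by
      linear_combination (-((r * (c - s₁)) ^ 2 + (r * (s₂ + s)) ^ 2)) * hcs
    rw [hsq]
    positivity
  · intro h
    obtain ⟨u, hu⟩ := exists_line_mem_unit_circle hp₁ h
    have hu0 : u ≠ 0 := by
      rintro rfl
      have := (one_lt_sq_iff_one_lt_abs s₂).mpr hs₂
      nlinarith [sq_nonneg s₁]
    obtain ⟨θ, hc, hs⟩ := exists_cos_eq_sin_eq (x := s₁ + u * p₁) (y := -(s₂ + u * p₂))
      (by rw [neg_sq, hu])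
    refine ⟨u⁻¹, θ / 2, inv_ne_zero hu0, ?_, ?_⟩
    · rw [mul_div_cancel₀ θ two_ne_zero, hc]
      field_simp
      ring
    · rw [mul_div_cancel₀ θ two_ne_zero, hs]
      field_simp
      ring
end

section
/- Assume |s₂| > 1 and T₊ := p₂ − p₁s₂ + p₂s₁ ≠ 0. If r ≠ 0 and φ ∈ (−π/2, π/2) satisfy 0 = p₁ + r(s₁ − cos(2φ)) and 0 = p₂ + r(s₂ + sin(2φ)), then Δ := p₁² + p₂² − (p₁s₂ − p₂s₁)² ≥ 0, r = −p₂/(s₂ + sin(2φ)), and tan(φ) equals either (p₁ + √Δ)/T₊ or (p₁ − √Δ)/T₊. -/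
/-- For `|s₂| > 1` and `T₊ = p₂ − p₁s₂ + p₂s₁ ≠ 0`, any nontrivial equilibrium
`(r, φ)` with `φ ∈ (−π/2, π/2)` satisfies `Δ ≥ 0`, `r = −p₂/(s₂ + sin 2φ)`, and
`tan φ = (p₁ ± √Δ)/T₊`. -/
theorem stmt_7 (p₁ p₂ s₁ s₂ : ℝ) (hs₂ : 1 < |s₂|)
    (hT : p₂ - p₁ * s₂ + p₂ * s₁ ≠ 0) (r φ : ℝ) (hr : r ≠ 0)
    (hφ : φ ∈ Set.Ioo (-(Real.pi / 2)) (Real.pi / 2))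
    (h₁ : 0 = p₁ + r * (s₁ - Real.cos (2 * φ)))
    (h₂ : 0 = p₂ + r * (s₂ + Real.sin (2 * φ))) :
    0 ≤ p₁ ^ 2 + p₂ ^ 2 - (p₁ * s₂ - p₂ * s₁) ^ 2 ∧
    r = -p₂ / (s₂ + Real.sin (2 * φ)) ∧
    (Real.tan φ = (p₁ + Real.sqrt (p₁ ^ 2 + p₂ ^ 2 - (p₁ * s₂ - p₂ * s₁) ^ 2))
        / (p₂ - p₁ * s₂ + p₂ * s₁) ∨
      Real.tan φ = (p₁ - Real.sqrt (p₁ ^ 2 + p₂ ^ 2 - (p₁ * s₂ - p₂ * s₁) ^ 2))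
        / (p₂ - p₁ * s₂ + p₂ * s₁)) := by
  have hK : (p₁ * s₂ - p₂ * s₁) + p₁ * Real.sin (2 * φ) + p₂ * Real.cos (2 * φ) = 0 := by
    linear_combination (-(s₂ + Real.sin (2 * φ))) * h₁ + (s₁ - Real.cos (2 * φ)) * h₂
  have hden : s₂ + Real.sin (2 * φ) ≠ 0 := by
    intro h
    have hs : |s₂| ≤ 1 := by
      rw [eq_neg_of_add_eq_zero_left h, abs_neg]
      exact Real.abs_sin_le_one _
    exact absurd hs (not_le.mpr hs₂)
  have hcos : Real.cos φ ≠ 0 := (Real.cos_pos_of_mem_Ioo hφ).ne'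
  have hsin : Real.sin φ = Real.tan φ * Real.cos φ := (Real.tan_mul_cos hcos).symm
  rw [Real.sin_two_mul, Real.cos_two_mul'] at hK
  have hquad : ((p₂ - p₁ * s₂ + p₂ * s₁) * Real.tan φ - p₁) ^ 2 =
      p₁ ^ 2 + p₂ ^ 2 - (p₁ * s₂ - p₂ * s₁) ^ 2 := by
    apply mul_right_cancel₀ (pow_ne_zero 2 hcos)
    have hpyth := Real.sin_sq_add_cos_sq φ
    rw [hsin] at hK hpyth
    linear_combination (-(p₂ - p₁ * s₂ + p₂ * s₁)) * hK -
      (p₂ - p₁ * s₂ + p₂ * s₁) * (p₁ * s₂ - p₂ * s₁) * hpyth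
  refine ⟨hquad ▸ sq_nonneg _, ?_, ?_⟩
  · rw [eq_div_iff hden]
    linear_combination -h₂
  · rw [← hquad, Real.sqrt_sq_eq_abs, eq_div_iff hT, eq_div_iff hT]
    rcases abs_choice ((p₂ - p₁ * s₂ + p₂ * s₁) * Real.tan φ - p₁) with h | h
    · left
      rw [h]
      ring
    · right
      rw [h]
      ring
end

section
/- Assume n ≥ 4, |s₂| > 1, s₁ ≠ 0, (p₁, p₂) ≠ (0, 0), and p₂s₂ ≥ 0. Then the only zero of f is the origin: {z ∈ ℂ : f(z) = 0} = {0}. -/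
/-- If `|s₂| > 1`, `s₁ ≠ 0`, `𝐩 ≠ 0` and `p₂s₂ ≥ 0`, the only equilibrium of
`ż = f(z)` is the origin. -/
theorem stmt_9 (n : ℕ) (hn : 4 ≤ n) (p₁ p₂ s₁ s₂ : ℝ) (hs₂ : 1 < |s₂|)
    (hs₁ : s₁ ≠ 0) (hp : (p₁, p₂) ≠ (0, 0)) (hps : 0 ≤ p₂ * s₂) (f : ℂ → ℂ)
    (hf : ∀ z : ℂ, f z =
      ((p₁ : ℂ) + p₂ * Complex.I) * z ^ (n - 1) * (starRingEnd ℂ) z ^ (n - 2)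
        + ((s₁ : ℂ) + s₂ * Complex.I) * z ^ n * (starRingEnd ℂ) z ^ (n - 1)
        - (starRingEnd ℂ) z ^ (2 * n - 1)) :
    {z : ℂ | f z = 0} = {0} := by
  obtain ⟨m, rfl⟩ := Nat.exists_eq_add_of_le' hn
  have e₁ : m + 4 - 1 = m + 3 := rfl
  have e₂ : m + 4 - 2 = m + 2 := rfl
  have e₃ : 2 * (m + 4) - 1 = 2 * m + 7 := by omega
  simp only [e₁, e₂, e₃] at hf
  ext z
  simp only [Set.mem_ofPred_eq, Set.mem_singleton_iff]
  refine ⟨fun hz => ?_, fun hz => by simp [hf, hz]⟩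
  by_contra hz0
  rw [hf] at hz
  set w := (starRingEnd ℂ) z
  have hzw : z * w = ((Complex.normSq z : ℝ) : ℂ) := Complex.mul_conj z
  set R := Complex.normSq z
  have hR0 : 0 < R := Complex.normSq_pos.mpr hz0
  have hmul : ((p₁ : ℂ) + p₂ * Complex.I) * ((R ^ (m + 3) : ℝ) : ℂ)
      + ((s₁ : ℂ) + s₂ * Complex.I) * ((R ^ (m + 4) : ℝ) : ℂ) = w ^ (2 * (m + 4)) := by
    rw [Complex.ofReal_pow, Complex.ofReal_pow, ← hzw]
    linear_combination w * hz
  have him : p₂ * R ^ (m + 3) + s₂ * R ^ (m + 4) = (w ^ (2 * (m + 4))).im := by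
    rw [← hmul, Complex.add_im, Complex.im_mul_ofReal, Complex.im_mul_ofReal]
    simp
  have hbound : |(w ^ (2 * (m + 4))).im| ≤ R ^ (m + 4) := by
    refine (Complex.abs_im_le_norm _).trans_eq ?_
    rw [norm_pow, Complex.norm_conj, pow_mul, ← Complex.normSq_eq_norm_sq]
  rw [← him] at hbound
  have hpos : 0 < R ^ (m + 4) := pow_pos hR0 _
  have hps' : 0 ≤ p₂ * s₂ * R ^ (m + 3) := mul_nonneg hps (pow_pos hR0 _).le
  obtain ⟨hlow, hupp⟩ := abs_le.mp hbound
  rcases lt_abs.mp hs₂ with h | h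
  · nlinarith [mul_pos (sub_pos.mpr h) hpos, mul_le_mul_of_nonneg_left hupp (by linarith : 0 ≤ s₂)]
  · nlinarith [mul_pos (sub_pos.mpr h) hpos, mul_le_mul_of_nonneg_left hlow (by linarith : 0 ≤ -s₂)]
end

section
/- Assume n ≥ 4, |s₂| > 1, s₁ ≠ 0, (p₁, p₂) ≠ (0, 0), p₂s₂ < 0, and 𝒬(p₁, p₂) < 0. Then the only zero of f is the origin: {z ∈ ℂ : f(z) = 0} = {0}. -/
/-- If `|s₂| > 1`, `s₁ ≠ 0`, `𝐩 ≠ 0`, `p₂s₂ < 0` and `𝒬(p₁,p₂) < 0`, the only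
equilibrium of `ż = f(z)` is the origin. -/
theorem stmt_10 (n : ℕ) (hn : 4 ≤ n) (p₁ p₂ s₁ s₂ : ℝ) (hs₂ : 1 < |s₂|)
    (hs₁ : s₁ ≠ 0) (hp : (p₁, p₂) ≠ (0, 0)) (hps : p₂ * s₂ < 0)
    (hQ : p₁ ^ 2 + p₂ ^ 2 - (p₁ * s₂ - p₂ * s₁) ^ 2 < 0) (f : ℂ → ℂ)
    (hf : ∀ z : ℂ, f z =
      ((p₁ : ℂ) + p₂ * Complex.I) * z ^ (n - 1) * (starRingEnd ℂ) z ^ (n - 2)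
        + ((s₁ : ℂ) + s₂ * Complex.I) * z ^ n * (starRingEnd ℂ) z ^ (n - 1)
        - (starRingEnd ℂ) z ^ (2 * n - 1)) :
    {z : ℂ | f z = 0} = {0} := by
  ext z
  obtain ⟨m, rfl⟩ : ∃ m, n = m + 2 := ⟨n - 2, by omega⟩
  have e₁ : m + 2 - 1 = m + 1 := by omega
  have e₂ : m + 2 - 2 = m := by omega
  have e₃ : 2 * (m + 2) - 1 = 2 * m + 1 + 2 := by omega
  simp only [Set.mem_ofPred_eq, Set.mem_singleton_iff, hf, e₁, e₂, e₃]
  refine ⟨fun h => ?_, fun h => by subst h; simp⟩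
  by_contra hz
  set ρ : ℝ := Complex.normSq z with hρ
  set w : ℂ := (p₁ : ℂ) + p₂ * Complex.I + ((s₁ : ℂ) + s₂ * Complex.I) * (ρ : ℂ) with hw
  have hfac : z ^ (m + 1) * (starRingEnd ℂ) z ^ m * w =
      (starRingEnd ℂ) z ^ (2 * m + 1 + 2) := by
    rw [hw, hρ, ← Complex.mul_conj]
    linear_combination h
  -- Comparing moduli eliminates the argument of `z`.
  have hnorm : Complex.normSq w = ρ ^ 2 := by
    have h' := congrArg Complex.normSq hfac
    simp only [map_mul, map_pow, Complex.normSq_conj, ← hρ] at h'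
    have hρ0 : ρ ^ (2 * m + 1) ≠ 0 := pow_ne_zero _ (by simpa [hρ] using hz)
    apply mul_left_cancel₀ hρ0
    linear_combination h'
  have hquad : (p₁ + s₁ * ρ) ^ 2 + (p₂ + s₂ * ρ) ^ 2 = ρ ^ 2 := by
    rw [← hnorm, Complex.normSq_apply]
    simp [hw]
    ring
  -- Completing the square in `ρ` exhibits the quadratic form as the discriminant.
  have hsq : ((s₁ ^ 2 + s₂ ^ 2 - 1) * ρ + (p₁ * s₁ + p₂ * s₂)) ^ 2 =
      p₁ ^ 2 + p₂ ^ 2 - (p₁ * s₂ - p₂ * s₁) ^ 2 := by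
    linear_combination (s₁ ^ 2 + s₂ ^ 2 - 1) * hquad
  exact (hsq ▸ hQ).not_ge (sq_nonneg _)
end

section
/- Assume n ≥ 4, |s₂| > 1, s₁ ≠ 0, (p₁, p₂) ≠ (0, 0), p₂s₂ < 0, and 𝒬(p₁, p₂) = 0. Then the zero set {z ∈ ℂ : f(z) = 0} is finite and has exactly 2n + 1 elements (the origin together with exactly one nontrivial equilibrium in each angular sector of opening π/n). -/
open Complex ComplexConjugate in
/-- For `z ≠ 0`, the equation `f z = 0` in terms of `z ^ (2 * n)` and `normSq z`. -/
theorem planar_field_eq_zero_iff {n : ℕ} (hn : 2 ≤ n) (p s : ℂ) {z : ℂ} (hz : z ≠ 0) :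
    p * z ^ (n - 1) * conj z ^ (n - 2) + s * z ^ n * conj z ^ (n - 1) - conj z ^ (2 * n - 1) = 0 ↔
      (normSq z : ℂ) ^ (n - 1) * (p + s * normSq z) = conj z ^ (2 * n) := by
  obtain ⟨m, rfl⟩ := Nat.exists_eq_add_of_le' hn
  have hcz : conj z ≠ 0 := (map_ne_zero _).2 hz
  rw [← mul_conj, show m + 2 - 1 = m + 1 by omega, Nat.add_sub_cancel,
    show 2 * (m + 2) - 1 = 2 * m + 3 by omega, ← mul_left_inj' hcz, ← sub_eq_zero (b := _ ^ _),
    zero_mul]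
  constructor <;> intro h <;> linear_combination h

/-- A nonzero complex number has exactly `k` distinct `k`-th roots. -/
theorem Complex.ncard_setOf_pow_eq {k : ℕ} (hk : k ≠ 0) {c : ℂ} (hc : c ≠ 0) :
    {z : ℂ | z ^ k = c}.Finite ∧ {z : ℂ | z ^ k = c}.ncard = k := by
  classical
  have hζ := Complex.isPrimitiveRoot_exp k hk
  have hset : {z : ℂ | z ^ k = c} = ↑(Polynomial.nthRoots k c).toFinset := by
    ext z
    simp [Polynomial.mem_nthRoots (Nat.pos_of_ne_zero hk)]
  rw [hset]
  refine ⟨Finset.finite_toSet _, ?_⟩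
  rw [Set.ncard_coe_finset, Multiset.toFinset_card_of_nodup (hζ.nthRoots_nodup hc),
    hζ.card_nthRoots, if_pos (IsAlgClosed.exists_pow_nat_eq c (Nat.pos_of_ne_zero hk))]

/-- If `𝒬(p₁,p₂) = 0`, the squared moduli `ρ` of the nonzero equilibria, which satisfy
`|𝐩 + 𝐬 ρ|² = ρ²`, all equal one positive number. -/
theorem exists_pos_forall_radius_iff {p₁ p₂ s₁ s₂ : ℝ} (hs₂ : 1 < |s₂|) (hps : p₂ * s₂ < 0)
    (hQ : p₁ ^ 2 + p₂ ^ 2 - (p₁ * s₂ - p₂ * s₁) ^ 2 = 0) :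
    ∃ r : ℝ, 0 < r ∧
      ∀ ρ : ℝ, (p₁ + s₁ * ρ) ^ 2 + (p₂ + s₂ * ρ) ^ 2 = ρ ^ 2 ↔ ρ = r := by
  have hs : 1 < s₂ ^ 2 := (one_lt_sq_iff_one_lt_abs s₂).2 hs₂
  have hp₂ : 0 < p₂ ^ 2 := by
    have : p₂ ≠ 0 := by rintro rfl; simp at hps
    positivity
  have hd : 0 < s₁ ^ 2 + s₂ ^ 2 - 1 := by nlinarith [sq_nonneg s₁]
  have hdot : p₁ * s₁ + p₂ * s₂ < 0 := by
    by_contra! h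
    have h1 : p₂ ^ 2 * s₂ ^ 2 ≤ -(p₁ * s₁ * (p₂ * s₂)) := by nlinarith
    nlinarith [mul_nonneg (sq_nonneg p₁) (sub_pos.2 hs).le, mul_pos hp₂ (sub_pos.2 hs),
      sq_nonneg (p₂ * s₁)]
  refine ⟨-(p₁ * s₁ + p₂ * s₂) / (s₁ ^ 2 + s₂ ^ 2 - 1), div_pos (neg_pos.2 hdot) hd, fun ρ ↦ ?_⟩
  have key : (s₁ ^ 2 + s₂ ^ 2 - 1) * ((p₁ + s₁ * ρ) ^ 2 + (p₂ + s₂ * ρ) ^ 2 - ρ ^ 2) =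
      (ρ * (s₁ ^ 2 + s₂ ^ 2 - 1) + (p₁ * s₁ + p₂ * s₂)) ^ 2 := by
    linear_combination -hQ
  rw [eq_div_iff hd.ne', ← sub_eq_zero, ← mul_right_inj' hd.ne', key, mul_zero, sq_eq_zero_iff,
    eq_neg_iff_add_eq_zero]


/-- If `|s₂| > 1`, `s₁ ≠ 0`, `𝐩 ≠ 0`, `p₂s₂ < 0` and `𝒬(p₁,p₂) = 0`, then
`ż = f(z)` has exactly `2n + 1` equilibria. -/
theorem stmt_11 (n : ℕ) (hn : 4 ≤ n) (p₁ p₂ s₁ s₂ : ℝ) (hs₂ : 1 < |s₂|)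
    (hs₁ : s₁ ≠ 0) (hp : (p₁, p₂) ≠ (0, 0)) (hps : p₂ * s₂ < 0)
    (hQ : p₁ ^ 2 + p₂ ^ 2 - (p₁ * s₂ - p₂ * s₁) ^ 2 = 0) (f : ℂ → ℂ)
    (hf : ∀ z : ℂ, f z =
      ((p₁ : ℂ) + p₂ * Complex.I) * z ^ (n - 1) * (starRingEnd ℂ) z ^ (n - 2)
        + ((s₁ : ℂ) + s₂ * Complex.I) * z ^ n * (starRingEnd ℂ) z ^ (n - 1)
        - (starRingEnd ℂ) z ^ (2 * n - 1)) :
    {z : ℂ | f z = 0}.Finite ∧ {z : ℂ | f z = 0}.ncard = 2 * n + 1 := by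
  obtain ⟨r, hr, hr_iff⟩ := exists_pos_forall_radius_iff hs₂ hps hQ
  set p : ℂ := (p₁ : ℂ) + p₂ * Complex.I
  set s : ℂ := (s₁ : ℂ) + s₂ * Complex.I
  have hnorm (ρ : ℝ) : Complex.normSq (p + s * ρ) = ρ ^ 2 ↔ ρ = r := by
    rw [← hr_iff, Complex.normSq_apply]
    simp [p, s, sq]
  set c : ℂ := (starRingEnd ℂ) ((r : ℂ) ^ (n - 1) * (p + s * r))
  have hc_norm : Complex.normSq c = (r ^ n) ^ 2 := by
    obtain ⟨m, rfl⟩ := Nat.exists_eq_add_of_le' (show 1 ≤ n by omega)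
    rw [Complex.normSq_conj, map_mul, (hnorm r).2 rfl, map_pow, Complex.normSq_ofReal,
      Nat.add_sub_cancel]
    ring
  have hc : c ≠ 0 := by
    rw [← Complex.normSq_pos, hc_norm]
    positivity
  have hne (z : ℂ) (hz : z ≠ 0) : f z = 0 ↔ z ^ (2 * n) = c := by
    have hz' : 0 < Complex.normSq z := Complex.normSq_pos.2 hz
    have hconj : z ^ (2 * n) = c ↔
        (r : ℂ) ^ (n - 1) * (p + s * r) = (starRingEnd ℂ) z ^ (2 * n) := by
      rw [← map_pow, eq_comm, ← (starRingEnd ℂ).injective.eq_iff, Complex.conj_conj]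
    rw [hf, planar_field_eq_zero_iff (by omega) p s hz]
    suffices h : (Complex.normSq z : ℂ) ^ (n - 1) * (p + s * Complex.normSq z) =
        (starRingEnd ℂ) z ^ (2 * n) ∨ z ^ (2 * n) = c → Complex.normSq z = r by
      constructor
      · intro h'
        rw [hconj, ← h (.inl h')]
        exact h'
      · intro h'
        rw [h (.inr h')]
        exact hconj.1 h'
    rintro (h | h)
    · rw [← hnorm]
      have h' := congrArg Complex.normSq h
      rw [map_mul, map_pow, map_pow, Complex.normSq_conj, Complex.normSq_ofReal, ← sq, ← pow_mul,
        show 2 * n = 2 * (n - 1) + 2 by omega, pow_add] at h'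
      exact mul_left_cancel₀ (by positivity) h'
    · have h' := congrArg Complex.normSq h
      rw [map_pow, hc_norm, ← pow_mul, mul_comm n 2] at h'
      exact (pow_left_inj₀ hz'.le hr.le (by omega)).1 h'
  have hset : {z : ℂ | f z = 0} = insert 0 {z : ℂ | z ^ (2 * n) = c} := by
    ext z
    rcases eq_or_ne z 0 with rfl | hz
    · simp [hf, show n ≠ 0 by omega, show n - 1 ≠ 0 by omega, show 2 * n - 1 ≠ 0 by omega]
    · simp [hne z hz, hz]
  have h0 : (0 : ℂ) ∉ {z : ℂ | z ^ (2 * n) = c} := by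
    simp [show n ≠ 0 by omega, hc.symm]
  obtain ⟨hfin, hcard⟩ := Complex.ncard_setOf_pow_eq (show 2 * n ≠ 0 by omega) hc
  rw [hset]
  exact ⟨hfin.insert 0, by rw [Set.ncard_insert_of_notMem h0 hfin, hcard]⟩
end

section
/- Assume n ≥ 4, |s₂| > 1, s₁ ≠ 0, (p₁, p₂) ≠ (0, 0), p₂s₂ < 0, and 𝒬(p₁, p₂) > 0. Then the zero set {z ∈ ℂ : f(z) = 0} is finite and has exactly 4n + 1 elements (the origin together with exactly two nontrivial equilibria in each angular sector of opening π/n). -/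
/-- A nonzero complex number has exactly `m` distinct `m`-th roots. -/
theorem card_nthRoots_toFinset_of_ne_zero {m : ℕ} (hm : m ≠ 0) {c : ℂ} (hc : c ≠ 0) :
    (Polynomial.nthRoots m c).toFinset.card = m := by
  classical
  have hζ := Complex.isPrimitiveRoot_exp m hm
  rw [Multiset.toFinset_card_of_nodup (hζ.nthRoots_nodup hc), hζ.card_nthRoots,
    if_pos (IsAlgClosed.exists_pow_nat_eq c (Nat.pos_of_ne_zero hm))]

/-- Away from the origin, `f z = 0` is a polynomial equation in `z` and `|z|²`. -/
theorem equilibrium_iff {n : ℕ} (hn : 2 ≤ n) (P S : ℂ) {z : ℂ} (hz : z ≠ 0) :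
    P * z ^ (n - 1) * (starRingEnd ℂ) z ^ (n - 2)
        + S * z ^ n * (starRingEnd ℂ) z ^ (n - 1) - (starRingEnd ℂ) z ^ (2 * n - 1) = 0 ↔
      z ^ (2 * n) * (P + S * (Complex.normSq z : ℂ)) = (Complex.normSq z : ℂ) ^ (n + 1) := by
  obtain ⟨m, rfl⟩ := Nat.exists_eq_add_of_le' hn
  have hR : (Complex.normSq z : ℂ) ≠ 0 := by
    exact_mod_cast (Complex.normSq_pos.2 hz).ne'
  have key : z ^ (2 * m + 3) * (P * z ^ (m + 2 - 1) * (starRingEnd ℂ) z ^ (m + 2 - 2)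
        + S * z ^ (m + 2) * (starRingEnd ℂ) z ^ (m + 2 - 1)
        - (starRingEnd ℂ) z ^ (2 * (m + 2) - 1))
      = (Complex.normSq z : ℂ) ^ m * (z ^ (2 * (m + 2)) * (P + S * (Complex.normSq z : ℂ))
        - (Complex.normSq z : ℂ) ^ (m + 2 + 1)) := by
    rw [Complex.normSq_eq_conj_mul_self, show m + 2 - 1 = m + 1 by omega,
      show m + 2 - 2 = m by omega, show 2 * (m + 2) - 1 = 2 * m + 3 by omega]
    ring
  rw [← sub_eq_zero (b := (Complex.normSq z : ℂ) ^ (m + 2 + 1)),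
    ← mul_right_inj' (pow_ne_zero (2 * m + 3) hz), key, mul_zero,
    mul_eq_zero, or_iff_right (pow_ne_zero m hR)]

/-- If `z ^ (2n) w = R ^ (n + 1)` with `R = |z|² > 0`, then `|w| = R`. -/
theorem normSq_eq_sq_of_pow_mul_eq {n : ℕ} {z w : ℂ} (hz : z ≠ 0)
    (h : z ^ (2 * n) * w = (Complex.normSq z : ℂ) ^ (n + 1)) :
    Complex.normSq w = Complex.normSq z ^ 2 := by
  have h' := congrArg Complex.normSq h
  rw [map_mul, map_pow, map_pow, Complex.normSq_ofReal] at h'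
  have hR : Complex.normSq z ^ (2 * n) ≠ 0 := pow_ne_zero _ (Complex.normSq_pos.2 hz).ne'
  apply mul_left_cancel₀ hR
  rw [h']
  ring

/-- If `z ^ (2n) w = R ^ (n + 1)` with `|w| = R > 0`, then `|z|² = R`. -/
theorem normSq_eq_of_pow_mul_eq {n : ℕ} (hn : n ≠ 0) {z w : ℂ} {R : ℝ} (hR : 0 < R)
    (hw : Complex.normSq w = R ^ 2) (h : z ^ (2 * n) * w = (R : ℂ) ^ (n + 1)) :
    Complex.normSq z = R := by
  have h' := congrArg Complex.normSq h
  rw [map_mul, map_pow, map_pow, Complex.normSq_ofReal, hw] at h'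
  refine (pow_left_inj₀ (Complex.normSq_nonneg z) hR.le (by omega : 2 * n ≠ 0)).1 ?_
  apply mul_right_cancel₀ (pow_pos hR 2).ne'
  rw [h']
  ring

/-- If `|s₂| > 1`, `s₁ ≠ 0`, `𝐩 ≠ 0`, `p₂s₂ < 0` and `𝒬(p₁,p₂) > 0`, then
`ż = f(z)` has exactly `4n + 1` equilibria. -/
theorem stmt_12 (n : ℕ) (hn : 4 ≤ n) (p₁ p₂ s₁ s₂ : ℝ) (hs₂ : 1 < |s₂|)
    (hs₁ : s₁ ≠ 0) (hp : (p₁, p₂) ≠ (0, 0)) (hps : p₂ * s₂ < 0)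
    (hQ : 0 < p₁ ^ 2 + p₂ ^ 2 - (p₁ * s₂ - p₂ * s₁) ^ 2) (f : ℂ → ℂ)
    (hf : ∀ z : ℂ, f z =
      ((p₁ : ℂ) + p₂ * Complex.I) * z ^ (n - 1) * (starRingEnd ℂ) z ^ (n - 2)
        + ((s₁ : ℂ) + s₂ * Complex.I) * z ^ n * (starRingEnd ℂ) z ^ (n - 1)
        - (starRingEnd ℂ) z ^ (2 * n - 1)) :
    {z : ℂ | f z = 0}.Finite ∧ {z : ℂ | f z = 0}.ncard = 4 * n + 1 := by
  classical
  have hs₂' : 1 < s₂ ^ 2 := (one_lt_sq_iff_one_lt_abs s₂).2 hs₂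
  have hp₂ : 0 < p₂ ^ 2 := by
    have : p₂ ≠ 0 := by rintro rfl; simp at hps
    positivity
  set a : ℝ := s₁ ^ 2 + s₂ ^ 2 - 1 with ha_def
  set b : ℝ := p₁ * s₁ + p₂ * s₂ with hb_def
  set q : ℝ := p₁ ^ 2 + p₂ ^ 2 - (p₁ * s₂ - p₂ * s₁) ^ 2 with hq_def
  have ha : 0 < a := by nlinarith [sq_nonneg s₁]
  have hb : b < 0 := by
    by_contra! h
    have h₁ : 0 ≤ (p₁ * s₁ + p₂ * s₂) * (-(p₂ * s₂)) :=
      mul_nonneg h (neg_nonneg.2 hps.le)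
    nlinarith [mul_nonneg (sq_nonneg p₁) (sub_nonneg.2 hs₂'.le),
      mul_pos hp₂ (sub_pos.2 hs₂'), sq_nonneg (p₂ * s₁)]
  have hsq : √q ^ 2 = q := Real.sq_sqrt hQ.le
  have hsq_pos : 0 < √q := Real.sqrt_pos.2 hQ
  have hqb : √q < -b := by
    refine Real.sqrt_lt' (by linarith) |>.2 ?_
    have : b ^ 2 - q = a * (p₁ ^ 2 + p₂ ^ 2) := by simp only [ha_def, hb_def, hq_def]; ring
    nlinarith [mul_pos ha (show 0 < p₁ ^ 2 + p₂ ^ 2 by positivity)]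
  set R₁ : ℝ := (-b - √q) / a with hR₁_def
  set R₂ : ℝ := (-b + √q) / a with hR₂_def
  have hR₁ : 0 < R₁ := div_pos (by linarith) ha
  have hR₂ : 0 < R₂ := div_pos (by linarith) ha
  have hR : R₁ ≠ R₂ := by
    have : R₁ < R₂ := by simp only [hR₁_def, hR₂_def]; gcongr; linarith
    exact this.ne
  set W : ℝ → ℂ := fun R => ((p₁ : ℂ) + p₂ * Complex.I) + ((s₁ : ℂ) + s₂ * Complex.I) * (R : ℂ)
    with hW_def
  have hW : ∀ R : ℝ, Complex.normSq (W R) = R ^ 2 ↔ R = R₁ ∨ R = R₂ := by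
    intro R
    have h₁ : Complex.normSq (W R) - R ^ 2
        = a * R ^ 2 + 2 * b * R + (p₁ ^ 2 + p₂ ^ 2) := by
      simp [hW_def, Complex.normSq_apply, ha_def, hb_def]; ring
    have h₂ : a * (a * R ^ 2 + 2 * b * R + (p₁ ^ 2 + p₂ ^ 2))
        = (a * R - (-b - √q)) * (a * R - (-b + √q)) := by
      have : b ^ 2 - q = a * (p₁ ^ 2 + p₂ ^ 2) := by simp only [ha_def, hb_def, hq_def]; ring
      linear_combination hsq - this
    rw [← sub_eq_zero, h₁, ← mul_right_inj' ha.ne', h₂, mul_zero, mul_eq_zero, sub_eq_zero,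
      sub_eq_zero, hR₁_def, hR₂_def, eq_div_iff ha.ne', eq_div_iff ha.ne', mul_comm R a]
  set A : ℝ → Finset ℂ := fun R => (Polynomial.nthRoots (2 * n) ((R : ℂ) ^ (n + 1) / W R)).toFinset
    with hA_def
  have hW_ne : ∀ R : ℝ, 0 < R → Complex.normSq (W R) = R ^ 2 → W R ≠ 0 := by
    intro R hR h h0
    rw [h0, map_zero] at h
    exact (pow_pos hR 2).ne h
  have hmem : ∀ R : ℝ, 0 < R → Complex.normSq (W R) = R ^ 2 → ∀ z : ℂ,
      z ∈ A R ↔ z ^ (2 * n) * W R = (R : ℂ) ^ (n + 1) := by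
    intro R hR h z
    rw [hA_def, Multiset.mem_toFinset, Polynomial.mem_nthRoots (by omega),
      eq_div_iff (hW_ne R hR h)]
  have hnorm : ∀ R : ℝ, 0 < R → Complex.normSq (W R) = R ^ 2 → ∀ z ∈ A R,
      Complex.normSq z = R := fun R hR h z hz =>
    normSq_eq_of_pow_mul_eq (by omega) hR h ((hmem R hR h z).1 hz)
  have hcard : ∀ R : ℝ, 0 < R → Complex.normSq (W R) = R ^ 2 → (A R).card = 2 * n := by
    intro R hR h
    exact card_nthRoots_toFinset_of_ne_zero (by omega)
      (div_ne_zero (pow_ne_zero _ (by exact_mod_cast hR.ne')) (hW_ne R hR h))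
  have hW₁ := (hW R₁).2 (Or.inl rfl)
  have hW₂ := (hW R₂).2 (Or.inr rfl)
  have hzero : {z : ℂ | f z = 0} = ((insert 0 (A R₁ ∪ A R₂) : Finset ℂ) : Set ℂ) := by
    ext z
    rw [Set.mem_ofPred_eq, Finset.mem_coe, Finset.mem_insert, Finset.mem_union]
    by_cases hz : z = 0
    · subst hz
      simp [hf, show n - 1 ≠ 0 by omega, show n ≠ 0 by omega, show 2 * n - 1 ≠ 0 by omega]
    rw [hf, equilibrium_iff (by omega) _ _ hz, or_iff_right hz]
    change z ^ (2 * n) * W (Complex.normSq z) = _ ↔ _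
    constructor
    · intro h
      have hn₁ := normSq_eq_sq_of_pow_mul_eq hz h
      have hzA := (hmem _ (Complex.normSq_pos.2 hz) hn₁ z).2 h
      rcases (hW _).1 hn₁ with e | e <;> rw [e] at hzA
      exacts [Or.inl hzA, Or.inr hzA]
    · rintro (h | h)
      · rw [hnorm R₁ hR₁ hW₁ z h]; exact (hmem R₁ hR₁ hW₁ z).1 h
      · rw [hnorm R₂ hR₂ hW₂ z h]; exact (hmem R₂ hR₂ hW₂ z).1 h
  have hdisj : Disjoint (A R₁) (A R₂) := Finset.disjoint_left.2 fun z h₁ h₂ =>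
    hR ((hnorm R₁ hR₁ hW₁ z h₁).symm.trans (hnorm R₂ hR₂ hW₂ z h₂))
  have h0 : (0 : ℂ) ∉ A R₁ ∪ A R₂ := by
    rw [Finset.mem_union]
    rintro (h | h)
    · exact hR₁.ne ((map_zero _).symm.trans (hnorm R₁ hR₁ hW₁ 0 h))
    · exact hR₂.ne ((map_zero _).symm.trans (hnorm R₂ hR₂ hW₂ 0 h))
  rw [hzero]
  refine ⟨Finset.finite_toSet _, ?_⟩
  rw [Set.ncard_coe_finset, Finset.card_insert_of_notMem h0, Finset.card_union_of_disjoint hdisj,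
    hcard R₁ hR₁ hW₁, hcard R₂ hR₂ hW₂]
  ring
end

section
/- Assume n ≥ 4, |s₂| > 1, p₂s₂ < 0, and 𝒬(p₁, p₂) = 0. If r > 0 and θ ∈ ℝ satisfy the equilibrium equations 0 = p₁ + r(s₁ − cos(2nθ)) and 0 = p₂ + r(s₂ + sin(2nθ)), then the Jacobian matrix of the polar system at (r, θ), namely the 2×2 matrix with rows (2p₁ + 4r(s₁ − cos(2nθ)), 4n r² sin(2nθ)) and (s₂ + sin(2nθ), 2n r cos(2nθ)), has determinant zero; in particular 0 is an eigenvalue of this matrix. -/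
/-- If `|s₂| > 1`, `p₂s₂ < 0` and `𝒬(p₁,p₂) = 0`, then at every nontrivial
equilibrium `(r, θ)` of the polar system the Jacobian matrix has determinant
zero; in particular `0` is an eigenvalue (there is a nonzero kernel vector). -/
theorem stmt_13 (n : ℕ) (hn : 4 ≤ n) (p₁ p₂ s₁ s₂ : ℝ) (hs₂ : 1 < |s₂|)
    (hps : p₂ * s₂ < 0) (hQ : p₁ ^ 2 + p₂ ^ 2 - (p₁ * s₂ - p₂ * s₁) ^ 2 = 0)
    (r θ : ℝ) (hr : 0 < r)
    (h₁ : 0 = p₁ + r * (s₁ - Real.cos (2 * n * θ)))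
    (h₂ : 0 = p₂ + r * (s₂ + Real.sin (2 * n * θ))) :
    (Matrix.det
      !![2 * p₁ + 4 * r * (s₁ - Real.cos (2 * n * θ)), 4 * n * r ^ 2 * Real.sin (2 * n * θ);
         s₂ + Real.sin (2 * n * θ), 2 * n * r * Real.cos (2 * n * θ)] = 0) ∧
    ∃ v : Fin 2 → ℝ, v ≠ 0 ∧
      Matrix.mulVec
        !![2 * p₁ + 4 * r * (s₁ - Real.cos (2 * n * θ)), 4 * n * r ^ 2 * Real.sin (2 * n * θ);
           s₂ + Real.sin (2 * n * θ), 2 * n * r * Real.cos (2 * n * θ)] v = 0 := by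
  rw [Matrix.exists_mulVec_eq_zero_iff, and_self, Matrix.det_fin_two_of]
  have hCS := Real.sin_sq_add_cos_sq (2 * n * θ)
  set C := Real.cos (2 * n * θ)
  set S := Real.sin (2 * n * θ)
  obtain rfl : p₁ = -(r * (s₁ - C)) := by linarith
  obtain rfl : p₂ = -(r * (s₂ + S)) := by linarith
  -- On equilibria `𝒬` is the square of the nonconstant factor of the determinant.
  have hsq : (r * (s₁ * C - s₂ * S - 1)) ^ 2 = 0 := by
    linear_combination hQ + r ^ 2 * (s₁ ^ 2 + s₂ ^ 2 - 1) * hCS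
  have hD : s₁ * C - s₂ * S - 1 = 0 :=
    (mul_eq_zero.mp (pow_eq_zero_iff two_ne_zero |>.mp hsq)).resolve_left hr.ne'
  linear_combination 4 * n * r ^ 2 * hD - 4 * n * r ^ 2 * hCS
end

section
/- Let U ⊆ ℝ be open and let r : ℝ → ℝ be differentiable on U with, for all θ ∈ U, p₂ + r(θ)(s₂ + sin(2nθ)) ≠ 0 and r'(θ)·(p₂ + r(θ)(s₂ + sin(2nθ))) = 2 r(θ)(p₁ + r(θ)(s₁ − cos(2nθ))). Define x(θ) = r(θ)/(p₂ + r(θ)(s₂ + sin(2nθ))). Then for every θ ∈ U, x is differentiable at θ and x'(θ) = A(θ)·x(θ)³ + B(θ)·x(θ)² + C(θ)·x(θ), i.e., x satisfies the Abel equation obtained from the system by the Cherkas transformation. -/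
/-- The Cherkas transformation `x = r/(p₂ + r(s₂ + sin 2nθ))` carries solutions of
the orbit equation `dr/dθ = 2r(p₁ + r(s₁ − cos 2nθ)) / (p₂ + r(s₂ + sin 2nθ))`
into solutions of the Abel equation `x' = A x³ + B x² + C x`. -/
theorem stmt_14 (n : ℕ) (hn : 4 ≤ n) (p₁ p₂ s₁ s₂ : ℝ) (hp₂ : p₂ ≠ 0)
    (A B C : ℝ → ℝ)
    (hA : ∀ θ : ℝ, A θ = (2 / p₂) *
      (p₁ + p₁ * s₂ ^ 2 - p₂ * s₁ * s₂
        + (2 * p₁ * s₂ - p₂ * s₁) * Real.sin (2 * n * θ)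
        + (-p₁ * Real.cos (2 * n * θ) + p₂ * s₂ + p₂ * Real.sin (2 * n * θ))
            * Real.cos (2 * n * θ)))
    (hB : ∀ θ : ℝ, B θ = (2 / p₂) *
      (-2 * p₁ * s₂ + p₂ * s₁ - 2 * p₁ * Real.sin (2 * n * θ)
        - (n + 1) * p₂ * Real.cos (2 * n * θ)))
    (hC : ∀ θ : ℝ, C θ = 2 * p₁ / p₂)
    (U : Set ℝ) (hU : IsOpen U) (r r' : ℝ → ℝ)
    (hr : ∀ θ ∈ U, HasDerivAt r (r' θ) θ)
    (hden : ∀ θ ∈ U, p₂ + r θ * (s₂ + Real.sin (2 * n * θ)) ≠ 0)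
    (horbit : ∀ θ ∈ U, r' θ * (p₂ + r θ * (s₂ + Real.sin (2 * n * θ)))
      = 2 * r θ * (p₁ + r θ * (s₁ - Real.cos (2 * n * θ))))
    (x : ℝ → ℝ)
    (hx : ∀ θ : ℝ, x θ = r θ / (p₂ + r θ * (s₂ + Real.sin (2 * n * θ)))) :
    ∀ θ ∈ U, HasDerivAt x (A θ * x θ ^ 3 + B θ * x θ ^ 2 + C θ * x θ) θ := by
  intro θ hθ
  have hD := hden θ hθ
  have ho := horbit θ hθ
  have harg : HasDerivAt (fun t : ℝ => 2 * (n : ℝ) * t) (2 * n) θ := by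
    simpa using (hasDerivAt_id θ).const_mul (2 * (n : ℝ))
  have hquot := (hr θ hθ).fun_div
    (((hr θ hθ).fun_mul (harg.sin.const_add s₂)).const_add p₂) hD
  rw [← funext hx] at hquot
  refine hquot.congr_deriv ?_
  rw [hA, hB, hC, hx]
  have hsc := Real.sin_sq_add_cos_sq (2 * n * θ)
  generalize Real.sin (2 * n * θ) = s at *
  generalize Real.cos (2 * n * θ) = c at *
  rw [← eq_div_iff hD] at ho
  rw [ho]
  field_simp
  grind
end

section
/- Assume |s₂| > 1 and p₂ ≠ 0, and let c(θ) = s₂ + sin(2nθ) (which never vanishes). Then the function x(θ) = 1/c(θ) is a solution of the Abel equation: for every θ ∈ ℝ, x is differentiable at θ and x'(θ) = A(θ)·x(θ)³ + B(θ)·x(θ)² + C(θ)·x(θ). Moreover x(0) = x(2π), so x is a non-contractible periodic solution; it corresponds to infinity of the original planar system. -/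
/-- For `|s₂| > 1` and `p₂ ≠ 0`, the function `x(θ) = 1/(s₂ + sin 2nθ)` is a
non-contractible periodic solution of the Abel equation `x' = A x³ + B x² + C x`,
with `x(0) = x(2π)`; it corresponds to infinity of the original planar system. -/
theorem stmt_15 (n : ℕ) (hn : 4 ≤ n) (p₁ p₂ s₁ s₂ : ℝ) (hp₂ : p₂ ≠ 0)
    (hs₂ : 1 < |s₂|) (A B C : ℝ → ℝ)
    (hA : ∀ θ : ℝ, A θ = (2 / p₂) *
      (p₁ + p₁ * s₂ ^ 2 - p₂ * s₁ * s₂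
        + (2 * p₁ * s₂ - p₂ * s₁) * Real.sin (2 * n * θ)
        + (-p₁ * Real.cos (2 * n * θ) + p₂ * s₂ + p₂ * Real.sin (2 * n * θ))
            * Real.cos (2 * n * θ)))
    (hB : ∀ θ : ℝ, B θ = (2 / p₂) *
      (-2 * p₁ * s₂ + p₂ * s₁ - 2 * p₁ * Real.sin (2 * n * θ)
        - (n + 1) * p₂ * Real.cos (2 * n * θ)))
    (hC : ∀ θ : ℝ, C θ = 2 * p₁ / p₂)
    (x : ℝ → ℝ) (hx : ∀ θ : ℝ, x θ = 1 / (s₂ + Real.sin (2 * n * θ))) :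
    (∀ θ : ℝ, HasDerivAt x (A θ * x θ ^ 3 + B θ * x θ ^ 2 + C θ * x θ) θ) ∧
    x 0 = x (2 * Real.pi) := by
  have hc : ∀ θ : ℝ, s₂ + Real.sin (2 * n * θ) ≠ 0 := by
    intro θ h
    have h_abs : |s₂| ≤ 1 := by
      rw [eq_neg_of_add_eq_zero_left h, abs_neg]
      exact Real.abs_sin_le_one _
    linarith
  refine ⟨fun θ => ?_, ?_⟩
  · have h_lin : HasDerivAt (fun t : ℝ => 2 * (n : ℝ) * t) (2 * n) θ := by
      simpa using (hasDerivAt_id θ).const_mul (2 * (n : ℝ))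
    have h_inv := (h_lin.sin.const_add s₂).fun_inv (hc θ)
    have hx_eq : x = fun t => (s₂ + Real.sin (2 * n * t))⁻¹ :=
      funext fun t => by rw [hx, one_div]
    rw [← hx_eq] at h_inv
    refine h_inv.congr_deriv ?_
    rw [hA, hB, hC, hx]
    have h_sq := Real.sin_sq_add_cos_sq (2 * n * θ)
    have h_ne := hc θ
    generalize Real.sin (2 * n * θ) = S at *
    generalize Real.cos (2 * n * θ) = K at *
    field_simp
    linear_combination p₁ * h_sq
  · rw [hx, hx, mul_zero, Real.sin_zero]
    have h_period : Real.sin (2 * n * (2 * Real.pi)) = 0 := by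
      have h := Real.sin_nat_mul_pi (4 * n)
      push_cast at h
      rw [← h]
      ring_nf
    rw [h_period]
end

section
/- Assume |s₂| > 1 and p₂ ≠ 0. The function A(θ) = (2/p₂)·[p₁ + p₁s₂² − p₂s₁s₂ + (2p₁s₂ − p₂s₁)·sin(2nθ) + (−p₁cos(2nθ) + p₂s₂ + p₂sin(2nθ))·cos(2nθ)] changes sign (i.e., there exist θ₁, θ₂ ∈ ℝ with A(θ₁) < 0 < A(θ₂)) if and only if 𝒬(p₁, p₂) > 0. -/
/-- The cubic Abel coefficient factors into a linear trigonometric polynomial and `s₂ + sin`. -/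
theorem abel_bracket_factor (p₁ p₂ s₁ s₂ x : ℝ) :
    p₁ + p₁ * s₂ ^ 2 - p₂ * s₁ * s₂ + (2 * p₁ * s₂ - p₂ * s₁) * Real.sin x
        + (-p₁ * Real.cos x + p₂ * s₂ + p₂ * Real.sin x) * Real.cos x
      = (s₂ + Real.sin x) * (p₁ * Real.sin x + p₂ * Real.cos x + (p₁ * s₂ - p₂ * s₁)) := by
  linear_combination -p₁ * Real.sin_sq_add_cos_sq x

/-- A trigonometric polynomial `a sin x + b cos x + d` takes values of both signs
if and only if `d ^ 2 < a ^ 2 + b ^ 2`. -/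
theorem exists_neg_and_pos_sin_add_cos_iff (a b d : ℝ) :
    ((∃ x : ℝ, a * Real.sin x + b * Real.cos x + d < 0) ∧
        ∃ x : ℝ, 0 < a * Real.sin x + b * Real.cos x + d)
      ↔ 0 < a ^ 2 + b ^ 2 - d ^ 2 := by
  constructor
  · rintro ⟨⟨x, hx⟩, y, hy⟩
    by_contra! h
    have bound (t : ℝ) : |a * Real.sin t + b * Real.cos t| ≤ |d| := by
      apply sq_le_sq.mp
      have key : (a * Real.sin t + b * Real.cos t) ^ 2
          = a ^ 2 + b ^ 2 - (a * Real.cos t - b * Real.sin t) ^ 2 := by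
        linear_combination (a ^ 2 + b ^ 2) * Real.sin_sq_add_cos_sq t
      linarith [sq_nonneg (a * Real.cos t - b * Real.sin t)]
    have hx' := (abs_le.mp (bound x)).1
    have hy' := (abs_le.mp (bound y)).2
    rcases abs_cases d with ⟨e, _⟩ | ⟨e, _⟩ <;> linarith
  · intro h
    let z : ℂ := ⟨b, a⟩
    have hcos : ‖z‖ * Real.cos z.arg = b := Complex.norm_mul_cos_arg z
    have hsin : ‖z‖ * Real.sin z.arg = a := Complex.norm_mul_sin_arg z
    have hval : a * Real.sin z.arg + b * Real.cos z.arg = ‖z‖ := by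
      rw [← hcos, ← hsin]
      linear_combination ‖z‖ * Real.sin_sq_add_cos_sq z.arg
    have hsq : d ^ 2 < ‖z‖ ^ 2 := by
      have : ‖z‖ ^ 2 = a ^ 2 + b ^ 2 := by
        rw [← hcos, ← hsin]
        linear_combination -‖z‖ ^ 2 * Real.sin_sq_add_cos_sq z.arg
      linarith
    obtain ⟨hl, hr⟩ := abs_lt.mp (abs_lt_of_sq_lt_sq hsq (norm_nonneg z))
    refine ⟨⟨z.arg + Real.pi, ?_⟩, z.arg, by linarith⟩
    rw [Real.sin_add_pi, Real.cos_add_pi]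
    linarith

/-- For `|s₂| > 1` and `p₂ ≠ 0`, the Abel coefficient `A(θ)` changes sign
if and only if `𝒬(p₁, p₂) = p₁² + p₂² − (p₁s₂ − p₂s₁)² > 0`. -/
theorem stmt_16 (n : ℕ) (hn : 4 ≤ n) (p₁ p₂ s₁ s₂ : ℝ) (hp₂ : p₂ ≠ 0)
    (hs₂ : 1 < |s₂|) (A : ℝ → ℝ)
    (hA : ∀ θ : ℝ, A θ = (2 / p₂) *
      (p₁ + p₁ * s₂ ^ 2 - p₂ * s₁ * s₂
        + (2 * p₁ * s₂ - p₂ * s₁) * Real.sin (2 * n * θ)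
        + (-p₁ * Real.cos (2 * n * θ) + p₂ * s₂ + p₂ * Real.sin (2 * n * θ))
            * Real.cos (2 * n * θ))) :
    (∃ θ₁ θ₂ : ℝ, A θ₁ < 0 ∧ 0 < A θ₂)
      ↔ 0 < p₁ ^ 2 + p₂ ^ 2 - (p₁ * s₂ - p₂ * s₁) ^ 2 := by
  have hn' : (2 * n : ℝ) ≠ 0 := by positivity
  have hA' (x : ℝ) : A (x / (2 * n)) = 2 / p₂ * (s₂ + Real.sin x)
      * (p₁ * Real.sin x + p₂ * Real.cos x + (p₁ * s₂ - p₂ * s₁)) := by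
    rw [hA, mul_div_cancel₀ x hn', abel_bracket_factor, mul_assoc]
  have hsubst (P : ℝ → Prop) : (∃ θ, P (A θ)) ↔ ∃ x : ℝ, P (A (x / (2 * n))) :=
    ⟨fun ⟨θ, h⟩ => ⟨2 * n * θ, by rwa [mul_div_cancel_left₀ θ hn']⟩, fun ⟨x, h⟩ => ⟨_, h⟩⟩
  rw [← exists_neg_and_pos_sin_add_cos_iff, ← exists_and_exists_comm,
    hsubst (· < 0), hsubst (0 < ·)]
  simp only [hA']
  have hsign : (∀ x, 0 < 2 / p₂ * (s₂ + Real.sin x)) ∨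
      ∀ x, 2 / p₂ * (s₂ + Real.sin x) < 0 := by
    rcases lt_abs.mp hs₂ with hs | hs <;> rcases hp₂.lt_or_gt with hp | hp
    · exact .inr fun x => mul_neg_of_neg_of_pos (div_neg_of_pos_of_neg two_pos hp)
        (by linarith [Real.neg_one_le_sin x])
    · exact .inl fun x => mul_pos (div_pos two_pos hp) (by linarith [Real.neg_one_le_sin x])
    · exact .inl fun x => mul_pos_of_neg_of_neg (div_neg_of_pos_of_neg two_pos hp)
        (by linarith [Real.sin_le_one x])
    · exact .inr fun x => mul_neg_of_pos_of_neg (div_pos two_pos hp)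
        (by linarith [Real.sin_le_one x])
  rcases hsign with h | h
  · simp only [mul_neg_iff, mul_pos_iff, h _, (h _).not_gt, true_and, false_and, or_false]
  · simp only [mul_neg_iff, mul_pos_iff, h _, (h _).not_gt, true_and, false_and,
      false_or]
    exact and_comm
end

section
/- For all real numbers s₁ < 0 and s₂ > 1 one has (s₂² − 1)(1 + s₁)/(s₁s₂ − √(s₁² + s₂² − 1)) − s₂ < −1. (This inequality shows that, in the case 𝒬(p₁,p₂) = 0 with p₁ chosen as p₁ = −p₂(s₁s₂ − √(s₁² + s₂² − 1))/(1 − s₂²), the saddle-node equilibrium (r₊, θ₊) satisfies cot(nθ₊) < −1, hence −π/(4n) < θ₊ < 0.) -/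
/-- For `s₁ < 0` and `s₂ > 1` one has
`(s₂² − 1)(1 + s₁)/(s₁s₂ − √(s₁² + s₂² − 1)) − s₂ < −1`,
the key inequality locating the saddle-node equilibria. -/
theorem stmt_18 (s₁ s₂ : ℝ) (hs₁ : s₁ < 0) (hs₂ : 1 < s₂) :
    (s₂ ^ 2 - 1) * (1 + s₁) / (s₁ * s₂ - Real.sqrt (s₁ ^ 2 + s₂ ^ 2 - 1)) - s₂ < -1 := by
  have hR : -s₁ < Real.sqrt (s₁ ^ 2 + s₂ ^ 2 - 1) :=
    Real.lt_sqrt_of_sq_lt (by nlinarith)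
  set R := Real.sqrt (s₁ ^ 2 + s₂ ^ 2 - 1)
  have hD : s₁ * s₂ - R < 0 := by nlinarith
  have hpos : 0 < (s₂ - 1) * (s₂ + 1 + s₁ + R) :=
    mul_pos (by linarith) (by linarith)
  have hlt : (s₂ ^ 2 - 1) * (1 + s₁) / (s₁ * s₂ - R) < s₂ - 1 := by
    rw [div_lt_iff_of_neg hD]
    linarith
  linarith
end
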